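/- Every linearly ordered set equipped with its order topology is a radial space: for every subset A and every point x in the closure of A, there exist a cardinal κ and a κ-sequence of points of A converging to x. -/

import Mathlib

open Cardinal Ordinal

/-- A `κ`-sequence (indexed by the ordinals below `o`) `f` converges to a point `x`. -/
def ConvSeq {X : Type u} [TopologicalSpace X] (o : Ordinal.{u}) (f : Ordinal.{u} → X)
    (x : X) : Prop :=
  ∀ U ∈ nhds x, ∃ β < o, ∀ α, β < α → α < o → f α ∈ U

open Set in
/-- A point in the closure of the part of `A` strictly below it is the limit of a sequence of
points of `A` of infinite length. -/
theorem exists_convSeq_of_mem_closure_inter_Iio {X : Type u} [LinearOrder X] [TopologicalSpace X]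
    [OrderTopology X] (A : Set X) (x : X) (hx : x ∈ closure (A ∩ Iio x)) :
    ∃ (κ : Cardinal.{u}) (f : Ordinal.{u} → X),
      ℵ₀ ≤ κ ∧ (∀ α < κ.ord, f α ∈ A) ∧ ConvSeq κ.ord f x := by
  set S : Set X := A ∩ Iio x
  have above : ∀ a < x, ∃ s : S, a < s := fun a ha => by
    obtain ⟨s, has, hs⟩ := mem_closure_iff_nhds.1 hx _ (Ioi_mem_nhds ha)
    exact ⟨⟨s, hs⟩, has⟩
  have : Nonempty S := (closure_nonempty_iff.1 ⟨x, hx⟩).to_subtype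
  have : NoMaxOrder S := ⟨fun s => above s s.2.2⟩
  obtain ⟨T, hT, hTcard⟩ := Order.exists_cof_eq S
  set κ := Order.cof S
  have hκ_inf : ℵ₀ ≤ κ := Order.aleph0_le_cof
  obtain ⟨r, _, hr⟩ := Cardinal.exists_ord_eq T
  rw [hTcard] at hr
  have bound : ∀ α, ∃ s : S, α < κ.ord → ∀ t : T, typein r t ≤ α → (t : S) < s := by
    intro α
    by_cases hα : α < κ.ord
    · have hcard : Cardinal.mk ((↑) '' {t : T | typein r t ≤ α} : Set S) < κ := by
        have hα' : α + 1 < type r :=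
          hr ▸ (Cardinal.isSuccLimit_ord hκ_inf).add_one_lt hα
        obtain ⟨b, hb⟩ := typein_surj r hα'
        refine mk_image_le.trans_lt ?_
        have hset : {t : T | typein r t ≤ α} = {t | r t b} := by
          ext t
          rw [mem_ofPred_eq, mem_ofPred_eq, ← typein_lt_typein r, hb, Order.lt_add_one_iff]
        rw [hset, coe_ofPred, ← card_typein, hb, ← lt_ord, hr]
        exact hα'
      obtain ⟨s, hs⟩ := not_isCofinal_iff.1 fun h => (Order.cof_le h).not_gt hcard
      exact ⟨s, fun _ t ht => hs t (mem_image_of_mem _ ht)⟩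
    · exact ⟨Classical.arbitrary S, fun h => absurd h hα⟩
  choose f hf using bound
  refine ⟨κ, fun α => f α, hκ_inf, fun α _ => (f α).2.1, fun U hU => ?_⟩
  obtain ⟨a, ha, haU⟩ := exists_Ioc_subset_of_mem_nhds hU
    ⟨Classical.arbitrary S, (Classical.arbitrary S).2.2⟩
  obtain ⟨s, hs⟩ := above a ha
  obtain ⟨t, htT, hst⟩ := hT s
  refine ⟨typein r ⟨t, htT⟩, hr ▸ typein_lt_type r _, fun α hα hακ => haU ⟨?_, (f α).2.2.le⟩⟩
  exact hs.trans_le (hst.trans (hf α hακ ⟨t, htT⟩ hα.le).le)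

open Set in
/-- Radiality of linearly ordered spaces, witnessed by sequences of infinite length. -/
theorem exists_infinite_convSeq_of_mem_closure {X : Type u} [LinearOrder X] [TopologicalSpace X]
    [OrderTopology X] (A : Set X) (x : X) (hx : x ∈ closure A) :
    ∃ (κ : Cardinal.{u}) (f : Ordinal.{u} → X),
      ℵ₀ ≤ κ ∧ (∀ α < κ.ord, f α ∈ A) ∧ ConvSeq κ.ord f x := by
  by_cases hxA : x ∈ A
  · exact ⟨ℵ₀, fun _ => x, le_rfl, fun _ _ => hxA, fun U hU =>
      ⟨0, by simp [omega0_pos], fun _ _ _ => mem_of_mem_nhds hU⟩⟩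
  have hA : A = (A ∩ Iio x) ∪ (A ∩ Ioi x) := by
    rw [← inter_union_distrib_left, Iio_union_Ioi, eq_comm, inter_eq_left]
    exact fun a ha hax => hxA (hax ▸ ha)
  rw [hA, closure_union] at hx
  rcases hx with hx | hx
  · exact exists_convSeq_of_mem_closure_inter_Iio A x hx
  · exact exists_convSeq_of_mem_closure_inter_Iio (X := Xᵒᵈ) A x hx

/-- every linear order with its order topology is radial: for every set
`A` and every point `x ∈ closure A` there is a cardinal `κ` and a `κ`-sequence of
points of `A` converging to `x`. -/
theorem stmt14 {X : Type u} [LinearOrder X] [TopologicalSpace X] [OrderTopology X]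
    (A : Set X) (x : X) (hx : x ∈ closure A) :
    ∃ (κ : Cardinal.{u}) (f : Ordinal.{u} → X),
      (∀ α < κ.ord, f α ∈ A) ∧ ConvSeq κ.ord f x := by
  obtain ⟨κ, f, -, hfA, hf⟩ := exists_infinite_convSeq_of_mem_closure A x hx
  exact ⟨κ, f, hfA, hf⟩
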